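/- Let l ≥ 2, let ξ ∈ V_l ⊖ S_l, and let m ≥ 1, n ≥ 0 be integers. Then q_l(h_{m+n}^r(ξ_{m,n})) = 0. -/

import Mathlib

noncomputable section

open scoped ComplexInnerProductSpace

namespace UCoxMasa

/-- The universal Coxeter matrix on `Fin L`: all off-diagonal entries are `0` (representing ∞). -/
def Mat (L : ℕ) : CoxeterMatrix (Fin L) where
  M := fun i j => if i = j then 1 else 0
  isSymm := by
    ext i j
    by_cases h : i = j <;> simp [Matrix.transpose, h, eq_comm]
  diagonal := fun i => by simp
  off_diagonal := fun i j h => by simp [h]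

/-- The universal Coxeter group on `L` generators: free product of `L` copies of `ℤ/2ℤ`. -/
abbrev W (L : ℕ) : Type := (Mat L).Group

/-- The distinguished Coxeter system of `W L`. -/
def cs (L : ℕ) : CoxeterSystem (Mat L) (W L) := CoxeterMatrix.toCoxeterSystem (Mat L)

/-- The simple reflection associated to `i : Fin L`. -/
def σ {L : ℕ} (i : Fin L) : W L := (cs L).simple i

/-- Word length on `W L` with respect to the generating set of simple reflections. -/
def len {L : ℕ} (w : W L) : ℕ := (cs L).length w

/-- The Hilbert space `ℓ²(W)`. -/
abbrev H (L : ℕ) : Type := lp (fun _ : W L => ℂ) 2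

/-- The standard orthonormal basis vector `δ_w` of `ℓ²(W)`. -/
def δ {L : ℕ} (w : W L) : H L :=
  letI := Classical.decEq (W L)
  lp.single 2 w 1

/-- `V l`: the linear span of `{δ_w : ℓ(w) = l}`. -/
def V (L : ℕ) (l : ℕ) : Submodule ℂ (H L) :=
  Submodule.span ℂ {x : H L | ∃ w : W L, len w = l ∧ x = δ w}

/-- `S_l`: the linear span of `q_l(h V_{l-1}) ∪ q_l(R_h V_{l-1})`,
given the projections `Q`, the operator `h` and the right operator `Rh`. -/
def Sl (L : ℕ) (Q : ℕ → (H L →L[ℂ] H L)) (h Rh : H L →L[ℂ] H L) (l : ℕ) :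
    Submodule ℂ (H L) :=
  Submodule.span ℂ
    ({x : H L | ∃ y ∈ V L (l - 1), x = Q l (h y)} ∪
      {x : H L | ∃ y ∈ V L (l - 1), x = Q l (Rh y)})

end UCoxMasa


namespace UCoxMasa

/-! ### Words and descents in the universal Coxeter group -/

/-- Words in the letters `Fin L` without two equal adjacent letters. -/
abbrev RedWord (L : ℕ) : Type := {l : List (Fin L) // l.IsChain (· ≠ ·)}

/-- Left multiplication by a letter, on reduced words. -/
def RedWord.letterMul {L : ℕ} (s : Fin L) : Function.End (RedWord L) := fun l =>
  if h : l.1.head? = some s then ⟨l.1.tail, l.2.tail⟩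
  else ⟨s :: l.1, List.isChain_cons.2 ⟨fun _ hy e => h (e ▸ hy), l.2⟩⟩

theorem RedWord.letterMul_letterMul {L : ℕ} (s : Fin L) (l : RedWord L) :
    letterMul s (letterMul s l) = l := by
  obtain ⟨l, hl⟩ := l
  cases l with
  | nil => simp [letterMul]
  | cons a l =>
    by_cases h : a = s
    · subst h
      cases l with
      | nil => simp [letterMul]
      | cons b l =>
        have : b ≠ a := fun e => by simp [e] at hl
        simp [letterMul, this]
    · simp [letterMul, h]

theorem RedWord.isLiftable_letterMul (L : ℕ) :
    (Mat L).IsLiftable (RedWord.letterMul (L := L)) := by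
  intro i j
  by_cases h : i = j
  · subst h
    simp only [CoxeterMatrix.diagonal, pow_one]
    funext l
    exact letterMul_letterMul i l
  · have : (Mat L) i j = 0 := if_neg h
    rw [this, pow_zero]

/-- The reduced word of an element of `W L`. -/
def redWord {L : ℕ} (w : W L) : RedWord L :=
  (cs L).lift ⟨_, RedWord.isLiftable_letterMul L⟩ w ⟨[], List.IsChain.nil⟩

theorem redWord_one {L : ℕ} : redWord (1 : W L) = ⟨[], List.IsChain.nil⟩ := by
  rw [redWord, map_one]
  rfl

theorem redWord_simple_mul {L : ℕ} (s : Fin L) (w : W L) :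
    redWord (σ s * w) = RedWord.letterMul s (redWord w) := by
  simp only [redWord, σ, map_mul, CoxeterSystem.lift_apply_simple]
  rfl

theorem σ_mul_σ_mul {L : ℕ} (s : Fin L) (w : W L) : σ s * (σ s * w) = w :=
  (cs L).simple_mul_simple_cancel_left s

theorem mul_σ_mul_σ {L : ℕ} (w : W L) (s : Fin L) : w * σ s * σ s = w :=
  (cs L).simple_mul_simple_cancel_right s

theorem wordProd_redWord {L : ℕ} (w : W L) : (cs L).wordProd (redWord w).1 = w := by
  induction w using (cs L).simple_induction_left with
  | one => simp [redWord_one]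
  | mul_simple_left w i ih =>
    change (cs L).wordProd (redWord (σ i * w)).1 = σ i * w
    rw [redWord_simple_mul]
    unfold RedWord.letterMul
    split_ifs with h
    · obtain ⟨t, ht⟩ : ∃ t, (redWord w).1 = i :: t := by
        cases hh : (redWord w).1 with
        | nil => simp [hh] at h
        | cons a t => simp [hh] at h; exact ⟨t, by rw [h]⟩
      rw [ht, CoxeterSystem.wordProd_cons] at ih
      simp only [ht, List.tail_cons]
      rw [← σ_mul_σ_mul i ((cs L).wordProd t)]
      exact congrArg _ ih
    · rw [CoxeterSystem.wordProd_cons, ih]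
      rfl

theorem length_redWord_wordProd_le {L : ℕ} (l : List (Fin L)) :
    (redWord ((cs L).wordProd l)).1.length ≤ l.length := by
  induction l with
  | nil => simp [redWord_one]
  | cons a l ih =>
    rw [CoxeterSystem.wordProd_cons]
    change (redWord (σ a * _)).1.length ≤ _
    rw [redWord_simple_mul]
    unfold RedWord.letterMul
    split_ifs with h
    · simp only [List.length_tail, List.length_cons]; omega
    · simp only [List.length_cons]; omega

theorem length_redWord {L : ℕ} (w : W L) : (redWord w).1.length = len w := by
  apply le_antisymm
  · obtain ⟨l, hl, rfl⟩ := (cs L).exists_isReduced w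
    exact (length_redWord_wordProd_le l).trans hl.eq.ge
  · conv_lhs => rw [← wordProd_redWord w]
    exact (cs L).length_wordProd_le _

theorem head_redWord_of_descent {L : ℕ} {s : Fin L} {w : W L} (h : len (σ s * w) < len w) :
    (redWord w).1.head? = some s := by
  by_contra hs
  rw [← length_redWord, ← length_redWord w, redWord_simple_mul, RedWord.letterMul, dif_neg hs] at h
  simp at h

theorem len_inv {L : ℕ} (w : W L) : len w⁻¹ = len w := (cs L).length_inv w

theorem σ_inv {L : ℕ} (s : Fin L) : (σ s : W L)⁻¹ = σ s := (cs L).inv_simple s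

theorem len_one {L : ℕ} : len (1 : W L) = 0 := (cs L).length_one

theorem len_mul_le {L : ℕ} (v w : W L) : len (v * w) ≤ len v + len w := (cs L).length_mul_le v w

theorem len_mul_σ {L : ℕ} (w : W L) (s : Fin L) :
    len (w * σ s) = len w + 1 ∨ len (w * σ s) + 1 = len w := (cs L).length_mul_simple w s

theorem len_σ_mul {L : ℕ} (s : Fin L) (w : W L) :
    len (σ s * w) = len w + 1 ∨ len (σ s * w) + 1 = len w := (cs L).length_simple_mul w s

theorem exists_left_descent {L : ℕ} {w : W L} (h : 0 < len w) : ∃ s, len (σ s * w) < len w :=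
  (cs L).exists_leftDescent_of_ne_one (by rintro rfl; simp [len_one] at h)

theorem exists_right_descent {L : ℕ} {w : W L} (h : 0 < len w) : ∃ s, len (w * σ s) < len w :=
  (cs L).exists_rightDescent_of_ne_one (by rintro rfl; simp [len_one] at h)

theorem len_mul_σ_eq {L : ℕ} (s : Fin L) (w : W L) : len (w * σ s) = len (σ s * w⁻¹) := by
  rw [← len_inv, mul_inv_rev, σ_inv]

theorem right_descent_unique {L : ℕ} {s t : Fin L} {w : W L} (hs : len (w * σ s) < len w)
    (ht : len (w * σ t) < len w) : s = t := by
  rw [len_mul_σ_eq, ← len_inv w] at hs ht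
  exact Option.some_injective _
    ((head_redWord_of_descent hs).symm.trans (head_redWord_of_descent ht))

theorem finite_sphere (L n : ℕ) : {w : W L | len w = n}.Finite := by
  refine ((List.finite_length_eq (Fin L) n).image (cs L).wordProd).subset fun w hw => ?_
  exact ⟨(redWord w).1, (length_redWord w).trans hw, wordProd_redWord w⟩

/-- The elements of length `n`, as a finite set. -/
def sphere (L n : ℕ) : Finset (W L) := (finite_sphere L n).toFinset

@[simp] theorem mem_sphere {L n : ℕ} {w : W L} : w ∈ sphere L n ↔ len w = n := by
  simp [sphere]

open Classical in
/-- Delete the last letter of the reduced word. -/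
def trunc {L : ℕ} (w : W L) : W L :=
  if h : ∃ t, len (w * σ t) < len w then w * σ h.choose else w

theorem trunc_eq {L : ℕ} {w : W L} {t : Fin L} (h : len (w * σ t) < len w) :
    trunc w = w * σ t := by
  have h' : ∃ t, len (w * σ t) < len w := ⟨t, h⟩
  rw [trunc, dif_pos h', right_descent_unique h'.choose_spec h]

theorem trunc_mul_σ {L : ℕ} {w : W L} {t : Fin L} (h : len w < len (w * σ t)) :
    trunc (w * σ t) = w := by
  rw [trunc_eq (t := t) (by rwa [mul_σ_mul_σ]), mul_σ_mul_σ]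

theorem exists_trunc_mul {L : ℕ} {w : W L} (h : 0 < len w) :
    ∃ t, w = trunc w * σ t ∧ len w = len (trunc w) + 1 := by
  obtain ⟨t, ht⟩ := exists_right_descent h
  refine ⟨t, ?_, ?_⟩
  · rw [trunc_eq ht, mul_σ_mul_σ]
  · rw [trunc_eq ht]
    have := len_mul_σ w t
    omega

theorem len_trunc {L : ℕ} {w : W L} (h : 0 < len w) : len (trunc w) + 1 = len w := by
  obtain ⟨t, -, h⟩ := exists_trunc_mul h
  exact h.symm

theorem trunc_of_len_eq_zero {L : ℕ} {w : W L} (h : len w = 0) : trunc w = w :=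
  dif_neg (by rintro ⟨t, ht⟩; omega)

/-- A nonempty reduced product `w * y` has the last letter of `y`. -/
theorem right_descent_mul_iff {L : ℕ} {w y : W L} (hy : 0 < len y)
    (hwy : len (w * y) = len w + len y) (t : Fin L) :
    len (w * y * σ t) < len (w * y) ↔ len (y * σ t) < len y := by
  have key : ∀ {r : Fin L}, len (y * σ r) < len y → len (w * y * σ r) < len (w * y) := by
    intro r hr
    have := len_mul_le w (y * σ r)
    rw [mul_assoc]
    omega
  refine ⟨fun h => ?_, key⟩
  obtain ⟨r, hr⟩ := exists_right_descent hy
  rwa [right_descent_unique h (key hr)]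

theorem len_mul_trunc_iff {L : ℕ} {w x : W L} (hx : 2 ≤ len x) :
    len (w * trunc x) = len w + len (trunc x) ↔ len (w * x) = len w + len x := by
  obtain ⟨t, hxt, hlen⟩ := exists_trunc_mul (w := x) (by omega)
  generalize trunc x = y at *
  subst hxt
  constructor
  · intro h
    have h1 := right_descent_mul_iff (by omega) h t
    have h2 := len_mul_σ (w * y) t
    rw [← mul_assoc]
    omega
  · intro h
    have h1 := len_mul_le w y
    have h2 := len_mul_σ (w * y) t
    rw [← mul_assoc] at h
    omega

theorem trunc_mul {L : ℕ} {w x : W L} (hx : 1 ≤ len x) (h : len (w * x) = len w + len x) :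
    trunc (w * x) = w * trunc x := by
  obtain ⟨t, ht⟩ := exists_right_descent hx
  rw [trunc_eq ht, trunc_eq ((right_descent_mul_iff hx h t).2 ht), mul_assoc]

theorem len_trunc_iterate {L : ℕ} (N : ℕ) {x : W L} {l : ℕ} (hx : len x = N + l) :
    len (trunc^[N] x) = l := by
  induction N generalizing x with
  | zero => simpa using hx
  | succ N ih =>
    rw [Function.iterate_succ_apply]
    apply ih
    have := len_trunc (w := x) (by omega)
    omega

theorem mul_eq_trunc_iterate {L : ℕ} (N : ℕ) {x w : W L} {l : ℕ} (hx : len x = N + l)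
    (hw : len w = N) (hxw : len (x * w) = l) : x * w = trunc^[N] x := by
  induction N generalizing x w with
  | zero =>
    obtain rfl : w = 1 := (cs L).length_eq_zero_iff.1 hw
    simp
  | succ N ih =>
    obtain ⟨s, hs⟩ := exists_left_descent (w := w) (by omega)
    have h1 := len_σ_mul s w
    have h2 := len_mul_σ x s
    have h3 : x * w = x * σ s * (σ s * w) := by rw [mul_assoc, σ_mul_σ_mul]
    have h4 := len_mul_le (x * σ s) (σ s * w)
    have h5 : len (x * σ s) ≤ len (x * w) + len (σ s * w) := by
      rw [h3]; exact (cs L).length_le_length_mul_add_right _ _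
    rw [Function.iterate_succ_apply, trunc_eq (w := x) (t := s) (by omega), h3]
    exact ih (by omega) (by omega) (by rwa [← h3])

theorem len_inv_mul_trunc_iterate {L : ℕ} (N : ℕ) (x : W L) :
    len (x⁻¹ * trunc^[N] x) ≤ N := by
  induction N with
  | zero => simp [len_one]
  | succ N ih =>
    rw [Function.iterate_succ_apply']
    generalize trunc^[N] x = y at *
    by_cases h : 0 < len y
    · obtain ⟨t, ht⟩ := exists_right_descent h
      rw [trunc_eq ht, ← mul_assoc]
      have := len_mul_σ (x⁻¹ * y) t
      omega
    · rw [trunc_of_len_eq_zero (by omega)]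
      omega

theorem card_ascents {L : ℕ} {y : W L} (hy : 0 < len y) :
    (Finset.univ.filter fun t : Fin L => len y < len (y * σ t)).card = L - 1 := by
  obtain ⟨r, hr⟩ := exists_right_descent hy
  have : (Finset.univ.filter fun t : Fin L => len y < len (y * σ t)) = Finset.univ.erase r := by
    ext t
    simp only [Finset.mem_filter, Finset.mem_univ, true_and, Finset.mem_erase, and_true]
    constructor
    · rintro h rfl
      omega
    · intro h
      have := len_mul_σ y t
      by_contra h'
      exact h (right_descent_unique (by omega) hr)
  rw [this, Finset.card_erase_of_mem (Finset.mem_univ r), Finset.card_univ, Fintype.card_fin]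

/-! ### Creation and truncation operators on finitely supported functions -/

/-- The finitely supported functions on the sphere of radius `k`. -/
abbrev supp (L k : ℕ) : Submodule ℂ (W L →₀ ℂ) := Finsupp.supported ℂ ℂ {w | len w = k}

theorem map_mem_of_mem_supported {α M : Type*} [AddCommGroup M] [Module ℂ M] {s : Set α}
    (A : (α →₀ ℂ) →ₗ[ℂ] M) (P : Submodule ℂ M) (h : ∀ x ∈ s, A (Finsupp.single x 1) ∈ P)
    {f : α →₀ ℂ} (hf : f ∈ Finsupp.supported ℂ ℂ s) : A f ∈ P := by
  rw [Finsupp.supported_eq_span_single] at hf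
  have : Submodule.span ℂ ((fun i => Finsupp.single i (1 : ℂ)) '' s) ≤ P.comap A := by
    rw [Submodule.span_le]
    rintro _ ⟨x, hx, rfl⟩
    exact h x hx
  exact this hf

theorem map_eq_of_mem_supported {α M : Type*} [AddCommGroup M] [Module ℂ M] {s : Set α}
    (A B : (α →₀ ℂ) →ₗ[ℂ] M)
    (h : ∀ x ∈ s, A (Finsupp.single x 1) = B (Finsupp.single x 1))
    {f : α →₀ ℂ} (hf : f ∈ Finsupp.supported ℂ ℂ s) : A f = B f := by
  have := map_mem_of_mem_supported (A - B) ⊥ (fun x hx => by simp [h x hx]) hf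
  simpa [sub_eq_zero] using this

/-- Left creation by all reduced words of length `m`. -/
def leftCreate (L m : ℕ) : (W L →₀ ℂ) →ₗ[ℂ] (W L →₀ ℂ) :=
  Finsupp.linearCombination ℂ fun x =>
    ∑ w ∈ sphere L m with len (w * x) = len w + len x, Finsupp.single (w * x) 1

/-- Right creation by all reduced words of length `n`. -/
def rightCreate (L n : ℕ) : (W L →₀ ℂ) →ₗ[ℂ] (W L →₀ ℂ) :=
  Finsupp.linearCombination ℂ fun x =>
    ∑ w ∈ sphere L n with len (x * w) = len x + len w, Finsupp.single (x * w) 1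

/-- Deletion of the last letter, extended linearly. -/
def delLast (L : ℕ) : (W L →₀ ℂ) →ₗ[ℂ] (W L →₀ ℂ) := Finsupp.lmapDomain ℂ ℂ trunc

theorem leftCreate_single {L : ℕ} (m : ℕ) (x : W L) :
    leftCreate L m (Finsupp.single x 1) =
      ∑ w ∈ sphere L m with len (w * x) = len w + len x, Finsupp.single (w * x) 1 := by
  simp [leftCreate]

theorem rightCreate_single {L : ℕ} (n : ℕ) (x : W L) :
    rightCreate L n (Finsupp.single x 1) =
      ∑ w ∈ sphere L n with len (x * w) = len x + len w, Finsupp.single (x * w) 1 := by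
  simp [rightCreate]

theorem delLast_single {L : ℕ} (x : W L) (c : ℂ) :
    delLast L (Finsupp.single x c) = Finsupp.single (trunc x) c :=
  Finsupp.mapDomain_single

theorem delLast_pow_single {L : ℕ} (N : ℕ) (x : W L) (c : ℂ) :
    (delLast L ^ N) (Finsupp.single x c) = Finsupp.single (trunc^[N] x) c := by
  induction N generalizing x with
  | zero => rfl
  | succ N ih => rw [pow_succ, Module.End.mul_apply, delLast_single, ih, Function.iterate_succ_apply]

theorem leftCreate_mem {L k : ℕ} (m : ℕ) {f : W L →₀ ℂ} (hf : f ∈ supp L k) :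
    leftCreate L m f ∈ supp L (m + k) := by
  refine map_mem_of_mem_supported _ _ (fun x (hx : len x = k) => ?_) hf
  rw [leftCreate_single]
  refine Submodule.sum_mem _ fun w hw => Finsupp.single_mem_supported _ _ ?_
  simp only [Finset.mem_filter, mem_sphere] at hw
  change len _ = _
  omega

theorem rightCreate_mem {L k : ℕ} (n : ℕ) {f : W L →₀ ℂ} (hf : f ∈ supp L k) :
    rightCreate L n f ∈ supp L (n + k) := by
  refine map_mem_of_mem_supported _ _ (fun x (hx : len x = k) => ?_) hf
  rw [rightCreate_single]
  refine Submodule.sum_mem _ fun w hw => Finsupp.single_mem_supported _ _ ?_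
  simp only [Finset.mem_filter, mem_sphere] at hw
  change len _ = _
  omega

theorem delLast_mem {L k : ℕ} {f : W L →₀ ℂ} (hf : f ∈ supp L (k + 1)) :
    delLast L f ∈ supp L k := by
  refine map_mem_of_mem_supported _ _ (fun x (hx : len x = k + 1) => ?_) hf
  rw [delLast_single]
  refine Finsupp.single_mem_supported _ _ ?_
  have := len_trunc (w := x) (by omega)
  change len _ = _
  omega

theorem delLast_leftCreate {L k : ℕ} (m : ℕ) (hk : 2 ≤ k) {f : W L →₀ ℂ} (hf : f ∈ supp L k) :
    delLast L (leftCreate L m f) = leftCreate L m (delLast L f) := by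
  refine map_eq_of_mem_supported (delLast L ∘ₗ leftCreate L m) (leftCreate L m ∘ₗ delLast L)
    (fun x (hx : len x = k) => ?_) hf
  simp only [LinearMap.comp_apply, delLast_single, leftCreate_single, map_sum,
    len_mul_trunc_iff (hx.symm ▸ hk)]
  refine Finset.sum_congr rfl fun w hw => ?_
  rw [trunc_mul (by omega) (Finset.mem_filter.1 hw).2]

theorem delLast_pow_leftCreate {L k : ℕ} (m n : ℕ) (hk : 1 ≤ k) {f : W L →₀ ℂ}
    (hf : f ∈ supp L (n + k)) :
    (delLast L ^ n) (leftCreate L m f) = leftCreate L m ((delLast L ^ n) f) := by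
  induction n generalizing f with
  | zero => rfl
  | succ n ih =>
    rw [pow_succ, Module.End.mul_apply, Module.End.mul_apply,
      delLast_leftCreate m (by omega) hf, ih]
    exact delLast_mem (by rwa [show n + k + 1 = n + 1 + k by omega])

open Classical in
theorem card_extensions {L n : ℕ} {x u : W L} (hx : 1 ≤ len x) (hu : len u = n)
    (hxu : len (x * u) = len x + len u) :
    (((sphere L (n + 1)).filter fun w => len (x * w) = len x + len w).filter
      fun w => trunc w = u).card = L - 1 := by
  rw [← card_ascents (y := x * u) (by omega)]
  symm
  refine Finset.card_bij (fun t _ => u * σ t) ?_ ?_ ?_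
  · intro t ht
    simp only [Finset.mem_filter, Finset.mem_univ, true_and, mem_sphere] at ht ⊢
    have h1 := len_mul_σ u t
    have h2 := len_mul_σ (x * u) t
    have h3 := len_mul_le x (u * σ t)
    rw [mul_assoc] at ht h2
    refine ⟨⟨by omega, by omega⟩, trunc_mul_σ (by omega)⟩
  · intro t ht t' ht' h
    simp only [Finset.mem_filter, Finset.mem_univ, true_and] at ht ht'
    refine right_descent_unique (w := x * u * σ t) (by rwa [mul_σ_mul_σ]) ?_
    rw [mul_assoc x u, h, ← mul_assoc, mul_σ_mul_σ]
    exact ht'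
  · intro w hw
    simp only [Finset.mem_filter, mem_sphere] at hw
    obtain ⟨t, hwt, -⟩ := exists_trunc_mul (w := w) (by omega)
    rw [hw.2] at hwt
    refine ⟨t, ?_, hwt.symm⟩
    simp only [Finset.mem_filter, Finset.mem_univ, true_and]
    rw [mul_assoc, ← hwt]
    omega

theorem delLast_rightCreate {L k : ℕ} (n : ℕ) (hk : 1 ≤ k) {f : W L →₀ ℂ} (hf : f ∈ supp L k) :
    delLast L (rightCreate L (n + 1) f) = (L - 1) • rightCreate L n f := by
  classical
  refine map_eq_of_mem_supported (delLast L ∘ₗ rightCreate L (n + 1)) ((L - 1) • rightCreate L n)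
    (fun x (hx : len x = k) => ?_) hf
  simp only [LinearMap.comp_apply, LinearMap.smul_apply, rightCreate_single, map_sum,
    delLast_single]
  rw [← Finset.sum_fiberwise_of_maps_to (g := trunc)
    (t := (sphere L n).filter fun u => len (x * u) = len x + len u), Finset.smul_sum]
  · refine Finset.sum_congr rfl fun u hu => ?_
    simp only [Finset.mem_filter, mem_sphere] at hu
    rw [← card_extensions (by omega) hu.1 hu.2, ← Finset.sum_const]
    refine Finset.sum_congr rfl fun w hw => ?_
    simp only [Finset.mem_filter, mem_sphere] at hw
    obtain ⟨t, hwt, hlen⟩ := exists_trunc_mul (w := w) (by omega)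
    rw [hw.2] at hwt hlen
    rw [hwt, ← mul_assoc, trunc_mul_σ]
    rw [mul_assoc, ← hwt]
    omega
  · intro w hw
    simp only [Finset.mem_filter, mem_sphere] at hw ⊢
    obtain ⟨t, hwt, hlen⟩ := exists_trunc_mul (w := w) (by omega)
    refine ⟨by omega, ?_⟩
    generalize trunc w = u at *
    subst hwt
    have h1 := len_mul_le x u
    have h2 := len_mul_σ (x * u) t
    rw [mul_assoc] at h2
    omega

theorem rightCreate_zero {L : ℕ} (f : W L →₀ ℂ) : rightCreate L 0 f = f := by
  refine map_eq_of_mem_supported (rightCreate L 0) LinearMap.id (s := Set.univ)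
    (fun x _ => ?_) (by simp)
  have : (sphere L 0).filter (fun w => len (x * w) = len x + len w) = {1} := by
    ext w
    simp only [Finset.mem_filter, mem_sphere, Finset.mem_singleton]
    constructor
    · rintro ⟨h, -⟩
      exact (cs L).length_eq_zero_iff.1 h
    · rintro rfl
      simp [len_one]
  simp [rightCreate_single, this]

theorem delLast_pow_rightCreate {L k : ℕ} (n : ℕ) (hk : 1 ≤ k) {f : W L →₀ ℂ}
    (hf : f ∈ supp L k) :
    (delLast L ^ n) (rightCreate L n f) = (L - 1) ^ n • f := by
  induction n with
  | zero => simp [rightCreate_zero]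
  | succ n ih =>
    rw [pow_succ, Module.End.mul_apply, delLast_rightCreate n hk hf, map_nsmul, ih, smul_smul,
      pow_succ']

theorem delLast_pow_leftCreate_rightCreate {L l m n : ℕ} (hl : 2 ≤ l) (hm : 1 ≤ m)
    {f : W L →₀ ℂ} (hf : f ∈ supp L l) (hDf : delLast L f = 0) :
    (delLast L ^ (m + n)) (leftCreate L m (rightCreate L n f)) = 0 := by
  obtain ⟨m, rfl⟩ : ∃ k, m = k + 1 := ⟨m - 1, by omega⟩
  rw [pow_add, Module.End.mul_apply,
    delLast_pow_leftCreate _ n (by omega) (rightCreate_mem n hf),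
    delLast_pow_rightCreate n (by omega) hf, pow_succ, Module.End.mul_apply, map_nsmul, map_nsmul,
    delLast_leftCreate _ hl hf, hDf]
  simp

theorem delLast_apply {L k : ℕ} (u : W L) {f : W L →₀ ℂ} (hf : f ∈ supp L (k + 1)) :
    delLast L f u = ∑ t with len u < len (u * σ t), f (u * σ t) := by
  have := map_eq_of_mem_supported (Finsupp.lapply u ∘ₗ delLast L)
    (∑ t with len u < len (u * σ t), (Finsupp.lapply (u * σ t) : (W L →₀ ℂ) →ₗ[ℂ] ℂ))
    (fun x (hx : len x = k + 1) => ?_) hf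
  · simpa using this
  classical
  simp only [LinearMap.comp_apply, LinearMap.sum_apply, delLast_single, Finsupp.lapply_apply,
    Finsupp.single_apply]
  obtain ⟨t₀, hx₀, hlen⟩ := exists_trunc_mul (w := x) (by omega)
  split_ifs with h
  · subst h
    rw [Finset.sum_eq_single t₀]
    · rw [if_pos hx₀]
    · intro t ht hne
      simp only [Finset.mem_filter, Finset.mem_univ, true_and] at ht
      refine if_neg fun h => hne ?_
      refine right_descent_unique (w := x) ?_ ?_
      · conv_lhs => rw [h, mul_σ_mul_σ]
        omega
      · conv_lhs => rw [hx₀, mul_σ_mul_σ]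
        omega
    · intro h
      simp only [Finset.mem_filter, Finset.mem_univ, true_and, ← hx₀] at h
      omega
  · symm
    refine Finset.sum_eq_zero fun t ht => if_neg fun hx => h ?_
    simp only [Finset.mem_filter, Finset.mem_univ, true_and] at ht
    rw [hx, trunc_mul_σ ht]

/-! ### Leading terms of the Hecke operators -/

/-- The canonical map from finitely supported functions to `ℓ²(W)`. -/
def toH (L : ℕ) : (W L →₀ ℂ) →ₗ[ℂ] H L := Finsupp.linearCombination ℂ δ

theorem toH_single {L : ℕ} (x : W L) : toH L (Finsupp.single x 1) = δ x := by simp [toH]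

/-- The span of the `δ y` with `y` satisfying `P`. -/
def spanδ {L : ℕ} (P : W L → Prop) : Submodule ℂ (H L) := Submodule.span ℂ (δ '' {y | P y})

theorem δ_mem_spanδ {L : ℕ} {P : W L → Prop} {y : W L} (h : P y) : δ y ∈ spanδ P :=
  Submodule.subset_span ⟨y, h, rfl⟩

theorem spanδ_mono {L : ℕ} {P P' : W L → Prop} (h : ∀ y, P y → P' y) : spanδ P ≤ spanδ P' :=
  Submodule.span_mono (Set.image_mono h)

theorem map_mem_of_mem_spanδ {L : ℕ} {P : W L → Prop} (A : H L →L[ℂ] H L)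
    (S : Submodule ℂ (H L)) (h : ∀ y, P y → A (δ y) ∈ S) {x : H L} (hx : x ∈ spanδ P) :
    A x ∈ S := by
  have : spanδ P ≤ S.comap (A : H L →ₗ[ℂ] H L) := by
    rw [spanδ, Submodule.span_le]
    rintro _ ⟨y, hy, rfl⟩
    exact h y hy
  exact this hx

section LeadingTerms

variable {L : ℕ} {p : ℂ} {e : W L ≃ W L} {T : Fin L → H L →L[ℂ] H L}
  {Tw : W L → H L →L[ℂ] H L}

theorem T_map_mem (hT : ∀ (s : Fin L) (w : W L), T s (δ (e w)) =
      if len (σ s * w) < len w then δ (e (σ s * w)) + p • δ (e w) else δ (e (σ s * w)))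
    {P P' : W L → Prop} (h1 : ∀ y, P y → P' y)
    (h2 : ∀ s y, P (e y) → P' (e (σ s * y))) (s : Fin L) {x : H L} (hx : x ∈ spanδ P) :
    T s x ∈ spanδ P' := by
  refine map_mem_of_mem_spanδ _ _ (fun y hy => ?_) hx
  obtain ⟨y, rfl⟩ := e.surjective y
  rw [hT]
  split_ifs
  · exact add_mem (δ_mem_spanδ (h2 s y hy)) (Submodule.smul_mem _ _ (δ_mem_spanδ (h1 _ hy)))
  · exact δ_mem_spanδ (h2 s y hy)

theorem Tw_top (he : ∀ y, len (e y) = len y)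
    (hT : ∀ (s : Fin L) (w : W L), T s (δ (e w)) =
      if len (σ s * w) < len w then δ (e (σ s * w)) + p • δ (e w) else δ (e (σ s * w)))
    (hTw1 : Tw 1 = 1)
    (hrec : ∀ (s : Fin L) (w : W L), len (σ s * w) < len w → Tw w = T s ∘L Tw (σ s * w))
    (w x : W L) :
    Tw w (δ (e x)) - (if len (w * x) = len w + len x then δ (e (w * x)) else 0) ∈
      spanδ fun y => len y < len w + len x := by
  induction hk : len w generalizing w with
  | zero =>
    obtain rfl : w = 1 := (cs L).length_eq_zero_iff.1 hk
    simp [hTw1]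
  | succ k ih =>
    obtain ⟨s, hs⟩ := exists_left_descent (w := w) (by omega)
    have hlen := len_σ_mul s w
    rw [hrec s w hs, ContinuousLinearMap.comp_apply]
    have hw : w = σ s * (σ s * w) := (σ_mul_σ_mul s w).symm
    have ih := ih (σ s * w) (by omega)
    generalize σ s * w = u at *
    subst hw
    have hTr := T_map_mem (P' := fun y => len y < k + 1 + len x) hT (fun y hy => by omega)
      (fun s y hy => by rw [he] at *; have := len_σ_mul s y; omega) s ih
    have h1 := len_σ_mul s (u * x)
    have h2 := len_mul_le u x
    rw [map_sub] at hTr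
    rw [← sub_add_sub_cancel]
    refine add_mem hTr ?_
    rw [mul_assoc]
    by_cases hux : len (u * x) = k + len x
    · rw [if_pos hux, hT]
      split_ifs
      · omega
      · rw [sub_zero]
        exact add_mem (δ_mem_spanδ (by rw [he]; omega))
          (Submodule.smul_mem _ _ (δ_mem_spanδ (by rw [he]; omega)))
      · simp
      · omega
    · rw [if_neg hux, if_neg (by omega)]
      simp

theorem Tw_bot (he : ∀ y, len (e y) = len y)
    (hT : ∀ (s : Fin L) (w : W L), T s (δ (e w)) =
      if len (σ s * w) < len w then δ (e (σ s * w)) + p • δ (e w) else δ (e (σ s * w)))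
    (hTw1 : Tw 1 = 1)
    (hrec : ∀ (s : Fin L) (w : W L), len (σ s * w) < len w → Tw w = T s ∘L Tw (σ s * w))
    (w x : W L) :
    Tw w (δ (e x)) - (if len (w * x) + len w = len x then δ (e (w * x)) else 0) ∈
      spanδ fun y => len x < len y + len w := by
  induction hk : len w generalizing w with
  | zero =>
    obtain rfl : w = 1 := (cs L).length_eq_zero_iff.1 hk
    simp [hTw1]
  | succ k ih =>
    obtain ⟨s, hs⟩ := exists_left_descent (w := w) (by omega)
    have hlen := len_σ_mul s w
    rw [hrec s w hs, ContinuousLinearMap.comp_apply]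
    have hw : w = σ s * (σ s * w) := (σ_mul_σ_mul s w).symm
    have ih := ih (σ s * w) (by omega)
    generalize σ s * w = u at *
    subst hw
    have hTr := T_map_mem (P' := fun y => len x < len y + (k + 1)) hT (fun y hy => by omega)
      (fun s y hy => by rw [he] at *; have := len_σ_mul s y; omega) s ih
    have h1 := len_σ_mul s (u * x)
    have h2 : len x ≤ len (u * x) + len u := (cs L).length_le_length_mul_add_left u x
    rw [map_sub] at hTr
    rw [← sub_add_sub_cancel]
    refine add_mem hTr ?_
    rw [mul_assoc]
    by_cases hux : len (u * x) + k = len x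
    · rw [if_pos hux, hT]
      split_ifs
      · rw [add_sub_cancel_left]
        exact Submodule.smul_mem _ _ (δ_mem_spanδ (by rw [he]; omega))
      · omega
      · omega
      · rw [sub_zero]
        exact δ_mem_spanδ (by rw [he]; omega)
    · rw [if_neg hux, if_neg (by omega)]
      simp

end LeadingTerms

theorem tsum_sphere {L : ℕ} (F : W L → H L →L[ℂ] H L) (n : ℕ) :
    ∑' w : {w : W L // len w = n}, F w = ∑ w ∈ sphere L n, F w := by
  rw [← Finset.tsum_subtype (sphere L n) F]
  exact (Equiv.subtypeEquivRight fun w => by simp).tsum_eq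
    (fun w : {w // w ∈ sphere L n} => F w)

theorem right_top_bot {L : ℕ} {p : ℂ} {Tr : Fin L → H L →L[ℂ] H L} {Twr : W L → H L →L[ℂ] H L}
    (hTr : ∀ (s : Fin L) (w : W L), Tr s (δ w) =
      if len (w * σ s) < len w then δ (w * σ s) + p • δ w else δ (w * σ s))
    (hTwr1 : Twr 1 = 1)
    (hrec : ∀ (s : Fin L) (w : W L), len (w * σ s) < len w → Twr w = Tr s ∘L Twr (w * σ s))
    (w x : W L) :
    (Twr w (δ x) - (if len (x * w) = len x + len w then δ (x * w) else 0) ∈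
      spanδ fun y => len y < len w + len x) ∧
    (Twr w (δ x) - (if len (x * w) + len w = len x then δ (x * w) else 0) ∈
      spanδ fun y => len x < len y + len w) := by
  have hlen : ∀ (s : Fin L) (w : W L), len (w⁻¹ * σ s) = len (σ s * w) := fun s w => by
    rw [← len_inv, mul_inv_rev, σ_inv, inv_inv]
  have hmul : ∀ (s : Fin L) (w : W L), (σ s * w)⁻¹ = w⁻¹ * σ s := fun s w => by
    rw [mul_inv_rev, σ_inv]
  have hT' : ∀ (s : Fin L) (w : W L), Tr s (δ (Equiv.inv (W L) w)) =
      if len (σ s * w) < len w then δ (Equiv.inv (W L) (σ s * w)) + p • δ (Equiv.inv (W L) w)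
      else δ (Equiv.inv (W L) (σ s * w)) := fun s w => by
    simp only [Equiv.inv_apply, hTr, hmul, hlen, len_inv]
  have hrec' : ∀ (s : Fin L) (w : W L), len (σ s * w) < len w →
      Twr w⁻¹ = Tr s ∘L Twr (σ s * w)⁻¹ := fun s w h => by
    rw [hmul]
    exact hrec s w⁻¹ (by rwa [hlen, len_inv])
  have h1 := Tw_top (Tw := fun w => Twr w⁻¹) len_inv hT' (by simpa using hTwr1) hrec' w⁻¹ x⁻¹
  have h2 := Tw_bot (Tw := fun w => Twr w⁻¹) len_inv hT' (by simpa using hTwr1) hrec' w⁻¹ x⁻¹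
  simp only [Equiv.inv_apply, inv_inv, ← mul_inv_rev, len_inv] at h1 h2
  exact ⟨by rwa [add_comm (len x)], h2⟩

theorem inner_δ_toH {L : ℕ} (x : W L) (f : W L →₀ ℂ) : ⟪δ x, toH L f⟫ = f x := by
  classical
  have := map_eq_of_mem_supported (s := Set.univ)
    ((innerSL ℂ (δ x) : H L →ₗ[ℂ] ℂ) ∘ₗ toH L) (Finsupp.lapply x) (fun y _ => ?_)
    (f := f) (by simp)
  · simpa using this
  · simp only [LinearMap.comp_apply, toH_single, Finsupp.lapply_apply, Finsupp.single_apply]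
    change ⟪δ x, δ y⟫ = _
    unfold δ
    rw [lp.inner_single_left, lp.single_apply, Pi.single_apply]
    by_cases h : x = y
    · simp [h]
    · simp [h, Ne.symm h]

section Projections

variable {L : ℕ} {Q : ℕ → H L →L[ℂ] H L}

theorem Q_eq_zero (hQ : ∀ (l : ℕ) (w : W L), Q l (δ w) = if len w = l then δ w else 0)
    {l : ℕ} {P : W L → Prop} (hP : ∀ y, P y → len y ≠ l) {x : H L} (hx : x ∈ spanδ P) :
    Q l x = 0 := by
  have := map_mem_of_mem_spanδ (Q l) ⊥ (fun y hy => by simp [hQ, hP y hy]) hx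
  simpa using this

theorem Q_toH (hQ : ∀ (l : ℕ) (w : W L), Q l (δ w) = if len w = l then δ w else 0)
    {l : ℕ} {f : W L →₀ ℂ} (hf : f ∈ supp L l) : Q l (toH L f) = toH L f :=
  map_eq_of_mem_supported ((Q l : H L →ₗ[ℂ] H L) ∘ₗ toH L) (toH L)
    (fun x (hx : len x = l) => by simp [toH_single, hQ, hx]) hf

/-- If `A` agrees with `B` on basis vectors modulo `S`, then so it does on their span. -/
theorem sub_toH_mem {A : H L →L[ℂ] H L} {B : (W L →₀ ℂ) →ₗ[ℂ] (W L →₀ ℂ)} {k : ℕ}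
    {S : Submodule ℂ (H L)}
    (h : ∀ x, len x = k → A (δ x) - toH L (B (Finsupp.single x 1)) ∈ S)
    {f : W L →₀ ℂ} (hf : f ∈ supp L k) : A (toH L f) - toH L (B f) ∈ S :=
  map_mem_of_mem_supported ((A : H L →ₗ[ℂ] H L) ∘ₗ toH L - toH L ∘ₗ B) S
    (fun x hx => by simpa [toH_single] using h x hx) hf

theorem Q_right_bot {p : ℂ} {Tr : Fin L → H L →L[ℂ] H L} {Twr : W L → H L →L[ℂ] H L}
    (hQ : ∀ (l : ℕ) (w : W L), Q l (δ w) = if len w = l then δ w else 0)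
    (hTr : ∀ (s : Fin L) (w : W L), Tr s (δ w) =
      if len (w * σ s) < len w then δ (w * σ s) + p • δ w else δ (w * σ s))
    (hTwr1 : Twr 1 = 1)
    (hrec : ∀ (s : Fin L) (w : W L), len (w * σ s) < len w → Twr w = Tr s ∘L Twr (w * σ s))
    {N l : ℕ} {f : W L →₀ ℂ} (hf : f ∈ supp L (N + l)) :
    Q l ((∑ w ∈ sphere L N, Twr w) (toH L f)) = toH L ((delLast L ^ N) f) := by
  refine map_eq_of_mem_supported
    ((Q l ∘L ∑ w ∈ sphere L N, Twr w : H L →L[ℂ] H L) ∘ₗ toH L) (toH L ∘ₗ delLast L ^ N)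
    (fun x (hx : len x = N + l) => ?_) hf
  simp only [LinearMap.comp_apply, toH_single, delLast_pow_single, ContinuousLinearMap.coe_coe,
    ContinuousLinearMap.comp_apply, sum_apply, map_sum]
  have key : ∀ w ∈ sphere L N,
      Q l (Twr w (δ x)) = if len (x * w) = l then δ (x * w) else 0 := by
    intro w hw
    rw [mem_sphere] at hw
    have h := Q_eq_zero hQ (fun y hy => by omega) (right_top_bot hTr hTwr1 hrec w x).2 (l := l)
    rw [map_sub, sub_eq_zero] at h
    rw [h]
    by_cases hl : len (x * w) = l
    · rw [if_pos (by omega), hQ, if_pos hl]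
    · rw [if_neg (by omega), if_neg hl, map_zero]
  rw [Finset.sum_congr rfl key, Finset.sum_eq_single (x⁻¹ * trunc^[N] x)]
  · rw [mul_inv_cancel_left, if_pos (len_trunc_iterate N hx)]
  · intro w hw hne
    rw [mem_sphere] at hw
    refine if_neg fun h => hne ?_
    rw [← mul_eq_trunc_iterate N hx hw h, inv_mul_cancel_left]
  · intro h
    exfalso
    apply h
    rw [mem_sphere]
    have h1 := len_inv_mul_trunc_iterate N x
    have h2 : len x⁻¹ ≤ len (x⁻¹ * trunc^[N] x) + len (trunc^[N] x) :=
      (cs L).length_le_length_mul_add_right _ _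
    rw [len_inv, len_trunc_iterate N hx] at h2
    omega

end Projections

theorem delLast_eq_zero {L k : ℕ} {p : ℂ} {Q : ℕ → H L →L[ℂ] H L} {Tr : Fin L → H L →L[ℂ] H L}
    (hQ : ∀ (l : ℕ) (w : W L), Q l (δ w) = if len w = l then δ w else 0)
    (hTr : ∀ (s : Fin L) (w : W L), Tr s (δ w) =
      if len (w * σ s) < len w then δ (w * σ s) + p • δ w else δ (w * σ s))
    {f : W L →₀ ℂ} (hf : f ∈ supp L (k + 1))
    (hperp : ∀ y ∈ V L k, ⟪toH L f, Q (k + 1) ((∑ s, Tr s) y)⟫ = 0) :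
    delLast L f = 0 := by
  ext u
  by_cases hu : len u = k
  · have h := hperp (δ u) (Submodule.subset_span ⟨u, hu, rfl⟩)
    rw [← inner_conj_symm, map_eq_zero] at h
    rw [delLast_apply u hf, Finsupp.zero_apply, ← h]
    simp only [sum_apply, map_sum, sum_inner, Finset.sum_filter]
    refine Finset.sum_congr rfl fun t _ => ?_
    have h1 := len_mul_σ u t
    rw [hTr]
    by_cases h2 : len u < len (u * σ t)
    · rw [if_pos h2, if_neg (by omega), hQ, if_pos (by omega), inner_δ_toH]
    · rw [if_neg h2, if_pos (by omega), map_add, map_smul, hQ, hQ, if_neg (by omega),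
        if_neg (by omega)]
      simp
  · have := delLast_mem hf
    rw [Finsupp.mem_supported'] at this
    exact this u hu

theorem statement9
    (L : ℕ) (hL : 3 ≤ L) (q p : ℝ) (hq : 0 < q) (hq1 : q ≤ 1)
    (hp : p = (q - 1) / Real.sqrt q)
    (T : Fin L → H L →L[ℂ] H L)
    (hT : ∀ (s : Fin L) (w : W L),
      T s (δ w) =
        if len (σ s * w) < len w then δ (σ s * w) + (p : ℂ) • δ w else δ (σ s * w))
    (h : H L →L[ℂ] H L) (hh : h = ∑ s, T s)
    (Tw : W L → H L →L[ℂ] H L) (hTw1 : Tw 1 = 1)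
    (hTwrec : ∀ (s : Fin L) (w : W L), len (σ s * w) < len w →
      Tw w = T s ∘L Tw (σ s * w))
    (hn : ℕ → H L →L[ℂ] H L)
    (hhn : ∀ n : ℕ, hn n = ∑' w : {w : W L // len w = n}, Tw (w : W L))
    (Tr : Fin L → H L →L[ℂ] H L)
    (hTr : ∀ (s : Fin L) (w : W L),
      Tr s (δ w) =
        if len (w * σ s) < len w then δ (w * σ s) + (p : ℂ) • δ w else δ (w * σ s))
    (Rh : H L →L[ℂ] H L) (hRh : Rh = ∑ s, Tr s)
    (Twr : W L → H L →L[ℂ] H L) (hTwr1 : Twr 1 = 1)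
    (hTwrrec : ∀ (s : Fin L) (w : W L), len (w * σ s) < len w →
      Twr w = Tr s ∘L Twr (w * σ s))
    (hnr : ℕ → H L →L[ℂ] H L)
    (hhnr : ∀ n : ℕ, hnr n = ∑' w : {w : W L // len w = n}, Twr (w : W L))
    (Q : ℕ → H L →L[ℂ] H L)
    (hQ : ∀ (l : ℕ) (w : W L), Q l (δ w) = if len w = l then δ w else 0)
    (l : ℕ) (hl : 2 ≤ l) (ξ : H L)
    (hξmem : ξ ∈ V L l)
    (hξperp : ∀ y ∈ Sl L Q h Rh l, ⟪ξ, y⟫ = 0)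
    (m n : ℕ) (hm : 1 ≤ m) :
    Q l (hnr (m + n) (Q (m + n + l) (hn m (hnr n ξ)))) = 0 := by
  subst hRh
  obtain ⟨f, hf, rfl⟩ : ∃ f ∈ supp L l, toH L f = ξ := by
    have hV : V L l = Submodule.span ℂ (δ '' {w : W L | len w = l}) := by
      rw [V]
      congr 1
      ext x
      simp [eq_comm]
    rw [hV, Finsupp.span_image_eq_map_linearCombination] at hξmem
    exact hξmem
  have hDf : delLast L f = 0 := by
    refine delLast_eq_zero (k := l - 1) hQ hTr (by rwa [Nat.sub_add_cancel (by omega)])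
      fun y hy => ?_
    rw [Nat.sub_add_cancel (by omega)]
    exact hξperp _ (Submodule.subset_span (Or.inr ⟨y, hy, rfl⟩))
  have hleft := Tw_top (e := Equiv.refl (W L)) (fun _ => rfl) hT hTw1 hTwrec
  simp only [Equiv.refl_apply] at hleft
  have hr : hnr n (toH L f) - toH L (rightCreate L n f) ∈ spanδ fun y => len y < n + l := by
    refine sub_toH_mem (fun x hx => ?_) hf
    rw [hhnr, tsum_sphere, rightCreate_single, map_sum, sum_apply,
      Finset.sum_filter, ← Finset.sum_sub_distrib]
    refine Submodule.sum_mem _ fun w hw => ?_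
    have := (right_top_bot hTr hTwr1 hTwrrec w x).1
    rw [mem_sphere.1 hw, hx] at this
    simpa only [toH_single, mem_sphere.1 hw, hx] using this
  have hl' : hn m (toH L (rightCreate L n f)) - toH L (leftCreate L m (rightCreate L n f)) ∈
      spanδ fun y => len y < m + (n + l) := by
    refine sub_toH_mem (fun x hx => ?_) (rightCreate_mem n hf)
    rw [hhn, tsum_sphere, leftCreate_single, map_sum, sum_apply,
      Finset.sum_filter, ← Finset.sum_sub_distrib]
    refine Submodule.sum_mem _ fun w hw => ?_
    have := hleft w x
    rw [mem_sphere.1 hw, hx] at this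
    simpa only [toH_single, mem_sphere.1 hw, hx] using this
  have hlow : hn m (hnr n (toH L f) - toH L (rightCreate L n f)) ∈
      spanδ fun y => len y < m + (n + l) := by
    refine map_mem_of_mem_spanδ _ _ (fun x hx => ?_) hr
    rw [hhn, tsum_sphere, sum_apply]
    refine Submodule.sum_mem _ fun w hw => ?_
    rw [mem_sphere] at hw
    rw [← sub_add_cancel (Tw w (δ x)) (if len (w * x) = len w + len x then δ (w * x) else 0)]
    refine add_mem (spanδ_mono (fun y hy => by omega) (hleft w x)) ?_
    split_ifs
    · exact δ_mem_spanδ (by omega)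
    · exact zero_mem _
  have hmem : leftCreate L m (rightCreate L n f) ∈ supp L (m + n + l) := by
    rw [add_assoc]
    exact leftCreate_mem m (rightCreate_mem n hf)
  have htop : Q (m + n + l) (hn m (hnr n (toH L f))) =
      toH L (leftCreate L m (rightCreate L n f)) := by
    have := Q_eq_zero hQ (l := m + n + l) (fun y hy => by omega) (add_mem hlow hl')
    rw [map_sub, sub_add_sub_cancel, map_sub, sub_eq_zero] at this
    rw [this, Q_toH hQ hmem]
  rw [htop, hhnr, tsum_sphere, Q_right_bot hQ hTr hTwr1 hTwrrec hmem,
    delLast_pow_leftCreate_rightCreate hl hm hf hDf, map_zero]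

end UCoxMasa
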